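/- Let φ = (φ_H, φ₃) be a smooth periodic vector field on Ω = M × (-1,1) with ∇·φ = 0, φ₃|_{z=0} = 0 and ∫_Ω φ = 0. Then ‖φ₃‖₂ ≤ ‖∇_H φ_H‖₂, ‖∂_z φ₃‖₂ ≤ ‖∇_H φ_H‖₂, ‖∇_H φ₃‖₂ ≤ ‖Δ_H φ_H‖₂, and consequently ‖φ‖₂ ≤ C ‖∇φ_H‖₂ and ‖∇_H φ‖₂ ≤ C ‖Δφ_H‖₂, with C depending only on L₁, L₂. -/

import Mathlib

open MeasureTheory Real Set

noncomputable section

abbrev Pt := ℝ × ℝ × ℝ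

/-- partial derivative in `x`. -/
def pdx (f : Pt → ℝ) (p : Pt) : ℝ := deriv (fun t => f (t, p.2.1, p.2.2)) p.1
/-- partial derivative in `y`. -/
def pdy (f : Pt → ℝ) (p : Pt) : ℝ := deriv (fun t => f (p.1, t, p.2.2)) p.2.1
/-- partial derivative in `z`. -/
def pdz (f : Pt → ℝ) (p : Pt) : ℝ := deriv (fun t => f (p.1, p.2.1, t)) p.2.2

/-- full Laplacian. -/
def lap (f : Pt → ℝ) : Pt → ℝ := fun p => pdx (pdx f) p + pdy (pdy f) p + pdz (pdz f) p
/-- horizontal Laplacian. -/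
def lapH (f : Pt → ℝ) : Pt → ℝ := fun p => pdx (pdx f) p + pdy (pdy f) p

/-- squared full gradient. -/
def gradSq (f : Pt → ℝ) (p : Pt) : ℝ := (pdx f p)^2 + (pdy f p)^2 + (pdz f p)^2
/-- squared horizontal gradient. -/
def gradHSq (f : Pt → ℝ) (p : Pt) : ℝ := (pdx f p)^2 + (pdy f p)^2

/-- the horizontal domain `M = (0,L₁) × (0,L₂)`. -/
def MSet (L1 L2 : ℝ) : Set (ℝ × ℝ) := Ioo 0 L1 ×ˢ Ioo 0 L2
/-- the domain `Ω = M × (-1,1)`. -/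
def OmegaSet (L1 L2 : ℝ) : Set Pt := Ioo 0 L1 ×ˢ (Ioo 0 L2 ×ˢ Ioo (-1 : ℝ) 1)

/-- integral over `Ω`. -/
def intOn (L1 L2 : ℝ) (G : Pt → ℝ) : ℝ := ∫ p in OmegaSet L1 L2, G p

/-- periodicity in `x`, `y`, `z` with periods `L₁`, `L₂`, `2`. -/
def Periodic3 (L1 L2 : ℝ) (f : Pt → ℝ) : Prop :=
  (∀ p : Pt, f (p.1 + L1, p.2.1, p.2.2) = f p) ∧
  (∀ p : Pt, f (p.1, p.2.1 + L2, p.2.2) = f p) ∧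
  (∀ p : Pt, f (p.1, p.2.1, p.2.2 + 2) = f p)

/-- squared `L²(Ω)` norm. -/
def L2sq (L1 L2 : ℝ) (F : Pt → ℝ) : ℝ := intOn L1 L2 (fun p => (F p)^2)
/-- `L²(Ω)` norm. -/
def L2n (L1 L2 : ℝ) (F : Pt → ℝ) : ℝ := Real.sqrt (L2sq L1 L2 F)
/-- `L²(Ω)` norm of the horizontal gradient. -/
def L2gradH (L1 L2 : ℝ) (F : Pt → ℝ) : ℝ := Real.sqrt (intOn L1 L2 (gradHSq F))
/-- `L²(Ω)` norm of the full gradient. -/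
def L2grad (L1 L2 : ℝ) (F : Pt → ℝ) : ℝ := Real.sqrt (intOn L1 L2 (gradSq F))

/-- first component of a horizontal vector field. -/
def c1 (v : Pt → ℝ × ℝ) : Pt → ℝ := fun p => (v p).1
/-- second component of a horizontal vector field. -/
def c2 (v : Pt → ℝ × ℝ) : Pt → ℝ := fun p => (v p).2

/-- horizontal divergence. -/
def divH (v : Pt → ℝ × ℝ) : Pt → ℝ := fun p => pdx (c1 v) p + pdy (c2 v) p

/-- squared `L²(Ω)` norm of a horizontal vector field. -/
def vL2sq (L1 L2 : ℝ) (v : Pt → ℝ × ℝ) : ℝ := L2sq L1 L2 (c1 v) + L2sq L1 L2 (c2 v)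
def vL2n (L1 L2 : ℝ) (v : Pt → ℝ × ℝ) : ℝ := Real.sqrt (vL2sq L1 L2 v)
/-- squared `L²(Ω)` norm of the full gradient of a horizontal vector field. -/
def vGradSq (L1 L2 : ℝ) (v : Pt → ℝ × ℝ) : ℝ :=
  intOn L1 L2 (fun p => gradSq (c1 v) p + gradSq (c2 v) p)
def vGradn (L1 L2 : ℝ) (v : Pt → ℝ × ℝ) : ℝ := Real.sqrt (vGradSq L1 L2 v)
/-- squared `L²(Ω)` norm of the Laplacian of a horizontal vector field. -/
def vLapSq (L1 L2 : ℝ) (v : Pt → ℝ × ℝ) : ℝ :=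
  intOn L1 L2 (fun p => (lap (c1 v) p)^2 + (lap (c2 v) p)^2)
def vLapn (L1 L2 : ℝ) (v : Pt → ℝ × ℝ) : ℝ := Real.sqrt (vLapSq L1 L2 v)
/-- periodicity of a horizontal vector field. -/
def vPeriodic (L1 L2 : ℝ) (v : Pt → ℝ × ℝ) : Prop :=
  Periodic3 L1 L2 (c1 v) ∧ Periodic3 L1 L2 (c2 v)

/-- directional derivative along `v`. -/
def dirD (v : Pt) (f : Pt → ℝ) : Pt → ℝ := fun p => fderiv ℝ f p v

lemma smooth_differentiable {f : Pt → ℝ} (hf : ContDiff ℝ (⊤ : ℕ∞) f) : Differentiable ℝ f :=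
  hf.differentiable (by simp)

lemma smooth_dirD {f : Pt → ℝ} (hf : ContDiff ℝ (⊤ : ℕ∞) f) (v : Pt) :
    ContDiff ℝ (⊤ : ℕ∞) (dirD v f) :=
  (hf.fderiv_right (m := (⊤ : ℕ∞)) (by simp)).clm_apply contDiff_const

lemma dirD_comm {f : Pt → ℝ} (hf : ContDiff ℝ (⊤ : ℕ∞) f) (v w : Pt) :
    dirD v (dirD w f) = dirD w (dirD v f) := by
  have hd : Differentiable ℝ (fderiv ℝ f) :=
    (hf.fderiv_right (m := (⊤ : ℕ∞)) (by simp)).differentiable (by simp)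
  have key (a b p : Pt) : dirD a (dirD b f) p = fderiv ℝ (fderiv ℝ f) p a b := by
    have := ((hd p).hasFDerivAt.clm_apply (hasFDerivAt_const b p)).fderiv
    unfold dirD
    rw [this]
    simp
  funext p
  rw [key, key]
  exact (hf.contDiffAt.isSymmSndFDerivAt (by simpa using WithTop.coe_le_coe.2 (le_top : (2 : ℕ∞) ≤ ⊤))) v w

lemma dirD_add {f g : Pt → ℝ} (hf : ContDiff ℝ (⊤ : ℕ∞) f) (hg : ContDiff ℝ (⊤ : ℕ∞) g) (v : Pt) :
    dirD v (fun p => f p + g p) = fun p => dirD v f p + dirD v g p := by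
  funext p
  simp [dirD, fderiv_fun_add (smooth_differentiable hf p) (smooth_differentiable hg p)]

lemma dirD_sub {f g : Pt → ℝ} (hf : ContDiff ℝ (⊤ : ℕ∞) f) (hg : ContDiff ℝ (⊤ : ℕ∞) g) (v : Pt) :
    dirD v (fun p => f p - g p) = fun p => dirD v f p - dirD v g p := by
  funext p
  simp [dirD, fderiv_fun_sub (smooth_differentiable hf p) (smooth_differentiable hg p)]

lemma dirD_neg (f : Pt → ℝ) (v : Pt) :
    dirD v (fun p => -f p) = fun p => -dirD v f p := by
  funext p
  simp [dirD, fderiv_fun_neg]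

lemma dirD_mul {f g : Pt → ℝ} (hf : ContDiff ℝ (⊤ : ℕ∞) f) (hg : ContDiff ℝ (⊤ : ℕ∞) g) (v : Pt) :
    dirD v (fun p => f p * g p) = fun p => f p * dirD v g p + dirD v f p * g p := by
  funext p
  simp [dirD, fderiv_fun_mul (smooth_differentiable hf p) (smooth_differentiable hg p), mul_comm]

/-- unit vector in the `x` direction. -/
def ex : Pt := (1, 0, 0)
/-- unit vector in the `y` direction. -/
def ey : Pt := (0, 1, 0)
/-- unit vector in the `z` direction. -/
def ez : Pt := (0, 0, 1)

lemma hasDerivAt_x {f : Pt → ℝ} (hf : ContDiff ℝ (⊤ : ℕ∞) f) (x y z : ℝ) :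
    HasDerivAt (fun t => f (t, y, z)) (dirD ex f (x, y, z)) x :=
  (smooth_differentiable hf (x, y, z)).hasFDerivAt.comp_hasDerivAt x
    ((hasDerivAt_id x).prodMk ((hasDerivAt_const x y).prodMk (hasDerivAt_const x z)))

lemma hasDerivAt_y {f : Pt → ℝ} (hf : ContDiff ℝ (⊤ : ℕ∞) f) (x y z : ℝ) :
    HasDerivAt (fun t => f (x, t, z)) (dirD ey f (x, y, z)) y :=
  (smooth_differentiable hf (x, y, z)).hasFDerivAt.comp_hasDerivAt y
    ((hasDerivAt_const y x).prodMk ((hasDerivAt_id y).prodMk (hasDerivAt_const y z)))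

lemma hasDerivAt_z {f : Pt → ℝ} (hf : ContDiff ℝ (⊤ : ℕ∞) f) (x y z : ℝ) :
    HasDerivAt (fun t => f (x, y, t)) (dirD ez f (x, y, z)) z :=
  (smooth_differentiable hf (x, y, z)).hasFDerivAt.comp_hasDerivAt z
    ((hasDerivAt_const z x).prodMk ((hasDerivAt_const z y).prodMk (hasDerivAt_id z)))

lemma pdx_eq_dirD {f : Pt → ℝ} (hf : ContDiff ℝ (⊤ : ℕ∞) f) : pdx f = dirD ex f :=
  funext fun p => (hasDerivAt_x hf p.1 p.2.1 p.2.2).deriv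

lemma pdy_eq_dirD {f : Pt → ℝ} (hf : ContDiff ℝ (⊤ : ℕ∞) f) : pdy f = dirD ey f :=
  funext fun p => (hasDerivAt_y hf p.1 p.2.1 p.2.2).deriv

lemma pdz_eq_dirD {f : Pt → ℝ} (hf : ContDiff ℝ (⊤ : ℕ∞) f) : pdz f = dirD ez f :=
  funext fun p => (hasDerivAt_z hf p.1 p.2.1 p.2.2).deriv

lemma Periodic3.dirD {L1 L2 : ℝ} {f : Pt → ℝ} (hf : Periodic3 L1 L2 f) (v : Pt) :
    Periodic3 L1 L2 (dirD v f) := by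
  have key (a : Pt) (ha : ∀ p, f (p + a) = f p) (p : Pt) :
      _root_.dirD v f (p + a) = _root_.dirD v f p := by
    have h : (fun q => f (q + a)) = f := funext ha
    unfold _root_.dirD
    rw [← fderiv_comp_add_right a, h]
  refine ⟨fun ⟨x, y, z⟩ => ?_, fun ⟨x, y, z⟩ => ?_, fun ⟨x, y, z⟩ => ?_⟩
  · have := key (L1, 0, 0) (fun ⟨x, y, z⟩ => by simpa using hf.1 (x, y, z)) (x, y, z)
    simpa using this
  · have := key (0, L2, 0) (fun ⟨x, y, z⟩ => by simpa using hf.2.1 (x, y, z)) (x, y, z)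
    simpa using this
  · have := key (0, 0, 2) (fun ⟨x, y, z⟩ => by simpa using hf.2.2 (x, y, z)) (x, y, z)
    simpa using this

lemma integrableOn_omega (L1 L2 : ℝ) {G : Pt → ℝ} (hG : Continuous G) :
    IntegrableOn G (OmegaSet L1 L2) := by
  have hK : IsCompact (Icc (0 : ℝ) L1 ×ˢ (Icc (0 : ℝ) L2 ×ˢ Icc (-1 : ℝ) 1)) :=
    isCompact_Icc.prod (isCompact_Icc.prod isCompact_Icc)
  exact (hG.continuousOn.integrableOn_compact hK).mono_set
    (prod_mono Ioo_subset_Icc_self (prod_mono Ioo_subset_Icc_self Ioo_subset_Icc_self))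

lemma measurableSet_omega (L1 L2 : ℝ) : MeasurableSet (OmegaSet L1 L2) :=
  measurableSet_Ioo.prod (measurableSet_Ioo.prod measurableSet_Ioo)

lemma intOn_add (L1 L2 : ℝ) {F G : Pt → ℝ} (hF : Continuous F) (hG : Continuous G) :
    intOn L1 L2 (fun p => F p + G p) = intOn L1 L2 F + intOn L1 L2 G :=
  integral_add (integrableOn_omega L1 L2 hF) (integrableOn_omega L1 L2 hG)

lemma intOn_sub (L1 L2 : ℝ) {F G : Pt → ℝ} (hF : Continuous F) (hG : Continuous G) :
    intOn L1 L2 (fun p => F p - G p) = intOn L1 L2 F - intOn L1 L2 G :=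
  integral_sub (integrableOn_omega L1 L2 hF) (integrableOn_omega L1 L2 hG)

lemma intOn_const_mul (L1 L2 c : ℝ) (F : Pt → ℝ) :
    intOn L1 L2 (fun p => c * F p) = c * intOn L1 L2 F :=
  integral_const_mul c F

lemma intOn_mono (L1 L2 : ℝ) {F G : Pt → ℝ} (hF : Continuous F) (hG : Continuous G)
    (h : ∀ p, F p ≤ G p) : intOn L1 L2 F ≤ intOn L1 L2 G :=
  integral_mono (integrableOn_omega L1 L2 hF) (integrableOn_omega L1 L2 hG) h

lemma intOn_nonneg (L1 L2 : ℝ) {F : Pt → ℝ} (h : ∀ p, 0 ≤ F p) : 0 ≤ intOn L1 L2 F :=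
  integral_nonneg h

lemma setIntegral_rect {a b c d : ℝ} (hab : a ≤ b) (hcd : c ≤ d) {F : ℝ × ℝ → ℝ}
    (hF : Continuous F) :
    ∫ q in Ioo a b ×ˢ Ioo c d, F q = ∫ s in a..b, ∫ t in c..d, F (s, t) := by
  have hi : IntegrableOn F (Ioo a b ×ˢ Ioo c d) (volume.prod volume) :=
    (hF.continuousOn.integrableOn_compact (isCompact_Icc.prod isCompact_Icc)).mono_set
      (prod_mono Ioo_subset_Icc_self Ioo_subset_Icc_self)
  rw [Measure.volume_eq_prod, setIntegral_prod _ hi]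
  simp only [intervalIntegral.integral_of_le hab, intervalIntegral.integral_of_le hcd,
    integral_Ioc_eq_integral_Ioo]

lemma intOn_eq_xyz {L1 L2 : ℝ} (h1 : 0 ≤ L1) (h2 : 0 ≤ L2) {G : Pt → ℝ} (hG : Continuous G) :
    intOn L1 L2 G = ∫ x in 0..L1, ∫ y in 0..L2, ∫ z in (-1)..1, G (x, y, z) := by
  have hi : IntegrableOn G (OmegaSet L1 L2) (volume.prod volume) := integrableOn_omega L1 L2 hG
  unfold intOn OmegaSet
  rw [Measure.volume_eq_prod, setIntegral_prod _ hi, intervalIntegral.integral_of_le h1,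
    integral_Ioc_eq_integral_Ioo]
  refine integral_congr_ae (Filter.Eventually.of_forall fun x => ?_)
  exact setIntegral_rect h2 (by norm_num) (F := fun q => G (x, q)) (by fun_prop)

lemma continuous_intervalIntegral {X : Type*} [TopologicalSpace X] [FirstCountableTopology X]
    [LocallyCompactSpace X] {F : X × ℝ → ℝ} (hF : Continuous F) (a b : ℝ) :
    Continuous fun x => ∫ t in a..b, F (x, t) :=
  intervalIntegral.continuous_parametric_intervalIntegral_of_continuous'
    (f := fun x t => F (x, t)) hF a b

lemma integral_swap {a b c d : ℝ} (hab : a ≤ b) (hcd : c ≤ d) {F : ℝ × ℝ → ℝ}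
    (hF : Continuous F) :
    ∫ s in a..b, ∫ t in c..d, F (s, t) = ∫ t in c..d, ∫ s in a..b, F (s, t) := by
  rw [← setIntegral_rect hab hcd hF,
    ← setIntegral_rect hcd hab (F := fun q => F (q.2, q.1)) (by fun_prop)]
  exact (setIntegral_prod_swap (Ioo a b) (Ioo c d) F).symm

lemma intOn_eq_xzy {L1 L2 : ℝ} (h1 : 0 ≤ L1) (h2 : 0 ≤ L2) {G : Pt → ℝ} (hG : Continuous G) :
    intOn L1 L2 G = ∫ x in 0..L1, ∫ z in (-1)..1, ∫ y in 0..L2, G (x, y, z) := by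
  rw [intOn_eq_xyz h1 h2 hG]
  refine intervalIntegral.integral_congr fun x _ => ?_
  exact integral_swap h2 (by norm_num) (F := fun q => G (x, q)) (by fun_prop)

lemma intOn_eq_yzx {L1 L2 : ℝ} (h1 : 0 ≤ L1) (h2 : 0 ≤ L2) {G : Pt → ℝ} (hG : Continuous G) :
    intOn L1 L2 G = ∫ y in 0..L2, ∫ z in (-1)..1, ∫ x in 0..L1, G (x, y, z) := by
  rw [intOn_eq_xyz h1 h2 hG, integral_swap h1 h2
    (F := fun q => ∫ z in (-1)..1, G (q.1, q.2, z))
    (continuous_intervalIntegral (F := fun r : (ℝ × ℝ) × ℝ => G (r.1.1, r.1.2, r.2))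
      (by fun_prop) _ _)]
  refine intervalIntegral.integral_congr fun y _ => ?_
  exact integral_swap h1 (by norm_num) (F := fun q => G (q.1, y, q.2)) (by fun_prop)

/-- smooth functions with the periodicity of the box. -/
structure SmoothPer (L1 L2 : ℝ) (f : Pt → ℝ) : Prop where
  smooth : ContDiff ℝ (⊤ : ℕ∞) f
  per : Periodic3 L1 L2 f

namespace SmoothPer

variable {L1 L2 : ℝ} {f g : Pt → ℝ}

lemma continuous (hf : SmoothPer L1 L2 f) : Continuous f := hf.smooth.continuous

lemma dirD (hf : SmoothPer L1 L2 f) (v : Pt) : SmoothPer L1 L2 (dirD v f) :=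
  ⟨smooth_dirD hf.smooth v, hf.per.dirD v⟩

lemma mul (hf : SmoothPer L1 L2 f) (hg : SmoothPer L1 L2 g) :
    SmoothPer L1 L2 (fun p => f p * g p) :=
  ⟨hf.smooth.mul hg.smooth, fun p => by simp only [hf.per.1 p, hg.per.1 p],
    fun p => by simp only [hf.per.2.1 p, hg.per.2.1 p],
    fun p => by simp only [hf.per.2.2 p, hg.per.2.2 p]⟩

lemma add (hf : SmoothPer L1 L2 f) (hg : SmoothPer L1 L2 g) :
    SmoothPer L1 L2 (fun p => f p + g p) :=
  ⟨hf.smooth.add hg.smooth, fun p => by simp only [hf.per.1 p, hg.per.1 p],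
    fun p => by simp only [hf.per.2.1 p, hg.per.2.1 p],
    fun p => by simp only [hf.per.2.2 p, hg.per.2.2 p]⟩

lemma sub (hf : SmoothPer L1 L2 f) (hg : SmoothPer L1 L2 g) :
    SmoothPer L1 L2 (fun p => f p - g p) :=
  ⟨hf.smooth.sub hg.smooth, fun p => by simp only [hf.per.1 p, hg.per.1 p],
    fun p => by simp only [hf.per.2.1 p, hg.per.2.1 p],
    fun p => by simp only [hf.per.2.2 p, hg.per.2.2 p]⟩

end SmoothPer

/-- the property that derivatives along `v` of smooth periodic functions have zero integral. -/
def ZeroMeanDir (L1 L2 : ℝ) (v : Pt) : Prop :=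
  ∀ f, SmoothPer L1 L2 f → intOn L1 L2 (dirD v f) = 0

lemma zeroMeanDir_ex {L1 L2 : ℝ} (h1 : 0 ≤ L1) (h2 : 0 ≤ L2) : ZeroMeanDir L1 L2 ex := by
  intro f hf
  have hc := (hf.dirD ex).continuous
  rw [intOn_eq_yzx h1 h2 hc]
  have key (y z : ℝ) : ∫ x in 0..L1, dirD ex f (x, y, z) = 0 := by
    rw [intervalIntegral.integral_eq_sub_of_hasDerivAt
      (fun x _ => hasDerivAt_x hf.smooth x y z)
      (Continuous.intervalIntegrable (by fun_prop) _ _)]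
    simpa [sub_eq_zero] using hf.per.1 (0, y, z)
  simp [key]

lemma zeroMeanDir_ey {L1 L2 : ℝ} (h1 : 0 ≤ L1) (h2 : 0 ≤ L2) : ZeroMeanDir L1 L2 ey := by
  intro f hf
  have hc := (hf.dirD ey).continuous
  rw [intOn_eq_xzy h1 h2 hc]
  have key (x z : ℝ) : ∫ y in 0..L2, dirD ey f (x, y, z) = 0 := by
    rw [intervalIntegral.integral_eq_sub_of_hasDerivAt
      (fun y _ => hasDerivAt_y hf.smooth x y z)
      (Continuous.intervalIntegrable (by fun_prop) _ _)]
    simpa [sub_eq_zero] using hf.per.2.1 (x, 0, z)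
  simp [key]

lemma zeroMeanDir_ez {L1 L2 : ℝ} (h1 : 0 ≤ L1) (h2 : 0 ≤ L2) : ZeroMeanDir L1 L2 ez := by
  intro f hf
  have hc := (hf.dirD ez).continuous
  rw [intOn_eq_xyz h1 h2 hc]
  have key (x y : ℝ) : ∫ z in (-1)..1, dirD ez f (x, y, z) = 0 := by
    rw [intervalIntegral.integral_eq_sub_of_hasDerivAt
      (fun z _ => hasDerivAt_z hf.smooth x y z)
      (Continuous.intervalIntegrable (by fun_prop) _ _)]
    have := hf.per.2.2 (x, y, -1)
    norm_num at this
    linarith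
  simp [key]

lemma intOn_dirD_mul_swap {L1 L2 : ℝ} {v w : Pt} (hv : ZeroMeanDir L1 L2 v)
    (hw : ZeroMeanDir L1 L2 w) {a b : Pt → ℝ} (ha : SmoothPer L1 L2 a) (hb : SmoothPer L1 L2 b) :
    intOn L1 L2 (fun p => dirD v a p * dirD w b p)
      = intOn L1 L2 (fun p => dirD w a p * dirD v b p) := by
  have e1 := hw _ ((ha.dirD v).mul hb)
  have e2 := hv _ ((ha.dirD w).mul hb)
  rw [dirD_mul (ha.dirD v).smooth hb.smooth, intOn_add L1 L2
    ((ha.dirD v).mul (hb.dirD w)).continuous (((ha.dirD v).dirD w).mul hb).continuous] at e1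
  rw [dirD_mul (ha.dirD w).smooth hb.smooth, intOn_add L1 L2
    ((ha.dirD w).mul (hb.dirD v)).continuous (((ha.dirD w).dirD v).mul hb).continuous,
    dirD_comm ha.smooth v w] at e2
  linarith

lemma intOn_dirD_sq {L1 L2 : ℝ} {v : Pt} (hv : ZeroMeanDir L1 L2 v) {a : Pt → ℝ}
    (ha : SmoothPer L1 L2 a) :
    intOn L1 L2 (fun p => dirD v a p ^ 2)
      = -intOn L1 L2 (fun p => a p * dirD v (dirD v a) p) := by
  have e1 := hv _ (ha.mul (ha.dirD v))
  rw [dirD_mul ha.smooth (ha.dirD v).smooth, intOn_add L1 L2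
    (ha.mul ((ha.dirD v).dirD v)).continuous ((ha.dirD v).mul (ha.dirD v)).continuous] at e1
  simp only [sq]
  linarith

lemma sq_intervalIntegral_le {a b : ℝ} (hab : a ≤ b) {g : ℝ → ℝ} (hg : Continuous g) :
    (∫ t in a..b, g t) ^ 2 ≤ (b - a) * ∫ t in a..b, g t ^ 2 := by
  rcases hab.eq_or_lt with rfl | hlt
  · simp
  set I := ∫ t in a..b, g t with hI
  have h0 : 0 ≤ ∫ t in a..b, ((b - a) * g t - I) ^ 2 :=
    intervalIntegral.integral_nonneg hab fun t _ => sq_nonneg _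
  have h1 : ∫ t in a..b, ((b - a) * g t - I) ^ 2
      = (b - a) * ((b - a) * (∫ t in a..b, g t ^ 2) - I ^ 2) := by
    have e : (fun t => ((b - a) * g t - I) ^ 2)
        = fun t => (b - a) ^ 2 * g t ^ 2 - 2 * (b - a) * I * g t + I ^ 2 := by
      funext t; ring
    rw [e, intervalIntegral.integral_add (Continuous.intervalIntegrable (by fun_prop) _ _)
      (Continuous.intervalIntegrable (by fun_prop) _ _),
      intervalIntegral.integral_sub (Continuous.intervalIntegrable (by fun_prop) _ _)
      (Continuous.intervalIntegrable (by fun_prop) _ _), intervalIntegral.integral_const_mul,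
      intervalIntegral.integral_const_mul, intervalIntegral.integral_const, ← hI]
    simp only [smul_eq_mul]
    ring
  rw [h1] at h0
  have := nonneg_of_mul_nonneg_right h0 (sub_pos.2 hlt)
  linarith

lemma sq_sub_le_integral_deriv {a b x y : ℝ} {f f' : ℝ → ℝ} (hf : ∀ t, HasDerivAt f (f' t) t)
    (hf' : Continuous f') (hx : x ∈ Icc a b) (hy : y ∈ Icc a b) :
    (f x - f y) ^ 2 ≤ (b - a) * ∫ t in a..b, f' t ^ 2 := by
  wlog hyx : y ≤ x generalizing x y
  · rw [← neg_sub, neg_sq]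
    exact this hy hx (le_of_not_ge hyx)
  rw [← intervalIntegral.integral_eq_sub_of_hasDerivAt (fun t _ => hf t)
    (hf'.intervalIntegrable y x)]
  refine (sq_intervalIntegral_le hyx hf').trans ?_
  have hm : ∫ t in y..x, f' t ^ 2 ≤ ∫ t in a..b, f' t ^ 2 :=
    intervalIntegral.integral_mono_interval hy.1 hyx hx.2
      (Filter.Eventually.of_forall fun t => sq_nonneg _)
      (Continuous.intervalIntegrable (by fun_prop) _ _)
  have hn : 0 ≤ ∫ t in y..x, f' t ^ 2 :=
    intervalIntegral.integral_nonneg hyx fun t _ => sq_nonneg _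
  have h1 := hx.2
  have h2 := hy.1
  exact mul_le_mul (by linarith) hm hn (by linarith)

lemma intervalIntegral_sq_le_of_zero {f f' : ℝ → ℝ} (hf : ∀ t, HasDerivAt f (f' t) t)
    (hf' : Continuous f') (h0 : f 0 = 0) :
    ∫ t in (-1)..1, f t ^ 2 ≤ ∫ t in (-1)..1, f' t ^ 2 := by
  have hfc : Continuous f := continuous_iff_continuousAt.2 fun t => (hf t).continuousAt
  have key (a b : ℝ) (hab : b - a = 1) (h : (0 : ℝ) ∈ Icc a b) :
      ∫ t in a..b, f t ^ 2 ≤ ∫ t in a..b, f' t ^ 2 := by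
    have := intervalIntegral.integral_mono_on (μ := volume) (by linarith : a ≤ b)
      (f := fun t => f t ^ 2) (g := fun _ => ∫ t in a..b, f' t ^ 2)
      (Continuous.intervalIntegrable (by fun_prop) _ _)
      (Continuous.intervalIntegrable (by fun_prop) _ _)
      (fun t ht => by simpa [h0, hab] using sq_sub_le_integral_deriv hf hf' ht h)
    simpa [hab] using this
  have h1 := key (-1) 0 (by norm_num) (by norm_num)
  have h2 := key 0 1 (by norm_num) (by norm_num)
  rw [← intervalIntegral.integral_add_adjacent_intervals (b := 0) (f := fun t => f t ^ 2)
    (Continuous.intervalIntegrable (by fun_prop) _ _)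
    (Continuous.intervalIntegrable (by fun_prop) _ _),
    ← intervalIntegral.integral_add_adjacent_intervals (b := 0) (f := fun t => f' t ^ 2)
    (Continuous.intervalIntegrable (by fun_prop) _ _)
    (Continuous.intervalIntegrable (by fun_prop) _ _)]
  exact add_le_add h1 h2

lemma intOn_mono_of_vertical {L1 L2 : ℝ} (h1 : 0 ≤ L1) (h2 : 0 ≤ L2) {F G : Pt → ℝ}
    (hF : Continuous F) (hG : Continuous G)
    (h : ∀ x y, ∫ z in (-1)..1, F (x, y, z) ≤ ∫ z in (-1)..1, G (x, y, z)) :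
    intOn L1 L2 F ≤ intOn L1 L2 G := by
  have hc {H : Pt → ℝ} (hH : Continuous H) :
      Continuous fun q : ℝ × ℝ => ∫ z in (-1)..1, H (q.1, q.2, z) :=
    continuous_intervalIntegral (F := fun r : (ℝ × ℝ) × ℝ => H (r.1.1, r.1.2, r.2))
      (by fun_prop) _ _
  rw [intOn_eq_xyz h1 h2 hF, intOn_eq_xyz h1 h2 hG]
  refine intervalIntegral.integral_mono h1 ?_ ?_ fun x => ?_
  · exact (continuous_intervalIntegral (hc hF) _ _).intervalIntegrable _ _
  · exact (continuous_intervalIntegral (hc hG) _ _).intervalIntegrable _ _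
  · refine intervalIntegral.integral_mono h2 ?_ ?_ fun y => h x y
    · exact ((hc hF).comp (by fun_prop : Continuous fun y : ℝ => (x, y))).intervalIntegrable _ _
    · exact ((hc hG).comp (by fun_prop : Continuous fun y : ℝ => (x, y))).intervalIntegrable _ _

/-- a smooth function vanishing on `z = 0` is controlled by its vertical derivative. -/
lemma intOn_sq_le_of_zero {L1 L2 : ℝ} (h1 : 0 ≤ L1) (h2 : 0 ≤ L2) {f : Pt → ℝ}
    (hf : ContDiff ℝ (⊤ : ℕ∞) f) (h0 : ∀ x y, f (x, y, 0) = 0) :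
    intOn L1 L2 (fun p => f p ^ 2) ≤ intOn L1 L2 (fun p => dirD ez f p ^ 2) := by
  have c := hf.continuous
  have c' := (smooth_dirD hf ez).continuous
  refine intOn_mono_of_vertical h1 h2 (by fun_prop) (by fun_prop) fun x y => ?_
  exact intervalIntegral_sq_le_of_zero (fun z => hasDerivAt_z hf x y z) (by fun_prop) (h0 x y)

lemma intOn_mono_on (L1 L2 : ℝ) {F G : Pt → ℝ} (hF : Continuous F) (hG : Continuous G)
    (h : ∀ p ∈ OmegaSet L1 L2, F p ≤ G p) : intOn L1 L2 F ≤ intOn L1 L2 G :=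
  setIntegral_mono_on (integrableOn_omega L1 L2 hF) (integrableOn_omega L1 L2 hG)
    (measurableSet_omega L1 L2) h

lemma sq_sub_le_three_segments {L1 L2 : ℝ} {u : Pt → ℝ} (hu : ContDiff ℝ (⊤ : ℕ∞) u)
    {p q : Pt} (hp : p ∈ OmegaSet L1 L2) (hq : q ∈ OmegaSet L1 L2) :
    (u p - u q) ^ 2 ≤ 3 * (L1 * (∫ s in 0..L1, dirD ex u (s, p.2.1, p.2.2) ^ 2)
      + L2 * (∫ s in 0..L2, dirD ey u (q.1, s, p.2.2) ^ 2)
      + 2 * ∫ s in (-1)..1, dirD ez u (q.1, q.2.1, s) ^ 2) := by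
  obtain ⟨x, y, z⟩ := p
  obtain ⟨x', y', z'⟩ := q
  obtain ⟨hx, hy, hz⟩ := hp
  obtain ⟨hx', hy', hz'⟩ := hq
  have cx := (smooth_dirD hu ex).continuous
  have cy := (smooth_dirD hu ey).continuous
  have cz := (smooth_dirD hu ez).continuous
  have i1 := sq_sub_le_integral_deriv (fun t => hasDerivAt_x hu t y z) (by fun_prop)
    (Ioo_subset_Icc_self hx) (Ioo_subset_Icc_self hx')
  have i2 := sq_sub_le_integral_deriv (fun t => hasDerivAt_y hu x' t z) (by fun_prop)
    (Ioo_subset_Icc_self hy) (Ioo_subset_Icc_self hy')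
  have i3 := sq_sub_le_integral_deriv (fun t => hasDerivAt_z hu x' y' t) (by fun_prop)
    (Ioo_subset_Icc_self hz) (Ioo_subset_Icc_self hz')
  norm_num at i1 i2 i3 ⊢
  nlinarith [sq_nonneg ((u (x, y, z) - u (x', y, z)) - (u (x', y, z) - u (x', y', z))),
    sq_nonneg ((u (x, y, z) - u (x', y, z)) - (u (x', y', z) - u (x', y', z'))),
    sq_nonneg ((u (x', y, z) - u (x', y', z)) - (u (x', y', z) - u (x', y', z')))]

lemma poincare {L1 L2 : ℝ} (h1 : 0 < L1) (h2 : 0 < L2) {u : Pt → ℝ}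
    (hu : ContDiff ℝ (⊤ : ℕ∞) u) (h0 : intOn L1 L2 u = 0) :
    intOn L1 L2 (fun p => u p ^ 2) ≤ 3 * (L1 ^ 2 * intOn L1 L2 (fun p => dirD ex u p ^ 2)
      + L2 ^ 2 * intOn L1 L2 (fun p => dirD ey u p ^ 2)
      + 4 * intOn L1 L2 (fun p => dirD ez u p ^ 2)) := by
  have cu := hu.continuous
  have cx := (smooth_dirD hu ex).continuous
  have cy := (smooth_dirD hu ey).continuous
  have cz := (smooth_dirD hu ez).continuous
  set X : ℝ × ℝ → ℝ := fun r => ∫ s in 0..L1, dirD ex u (s, r.1, r.2) ^ 2 with hX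
  set Y : ℝ × ℝ → ℝ := fun r => ∫ s in 0..L2, dirD ey u (r.1, s, r.2) ^ 2 with hY
  set Z : ℝ × ℝ → ℝ := fun r => ∫ s in (-1)..1, dirD ez u (r.1, r.2, s) ^ 2 with hZ
  have cX : Continuous X := continuous_intervalIntegral
    (F := fun r : (ℝ × ℝ) × ℝ => dirD ex u (r.2, r.1.1, r.1.2) ^ 2) (by fun_prop) _ _
  have cY : Continuous Y := continuous_intervalIntegral
    (F := fun r : (ℝ × ℝ) × ℝ => dirD ey u (r.1.1, r.2, r.1.2) ^ 2) (by fun_prop) _ _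
  have cZ : Continuous Z := continuous_intervalIntegral
    (F := fun r : (ℝ × ℝ) × ℝ => dirD ez u (r.1.1, r.1.2, r.2) ^ 2) (by fun_prop) _ _
  set W : ℝ → ℝ := fun x => ∫ z in (-1)..1, Y (x, z) with hW
  have cW : Continuous W := continuous_intervalIntegral cY _ _
  have iX : intOn L1 L2 (fun p => X p.2) = L1 * intOn L1 L2 (fun p => dirD ex u p ^ 2) := by
    rw [intOn_eq_yzx h1.le h2.le (by fun_prop), intOn_eq_yzx h1.le h2.le (by fun_prop)]
    simp [hX]
  have iY (x : ℝ) : intOn L1 L2 (fun p => Y (x, p.2.2)) = L1 * (L2 * W x) := by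
    rw [intOn_eq_xyz h1.le h2.le (by fun_prop)]
    simp [hW, mul_left_comm]
  have iW : intOn L1 L2 (fun p => W p.1)
      = 2 * L2 * intOn L1 L2 (fun p => dirD ey u p ^ 2) := by
    rw [intOn_eq_xyz h1.le h2.le (by fun_prop), intOn_eq_xzy h1.le h2.le (by fun_prop)]
    simp [hW, hY]
    ring
  have iZ : intOn L1 L2 (fun p => Z (p.1, p.2.1))
      = 2 * intOn L1 L2 (fun p => dirD ez u p ^ 2) := by
    rw [intOn_eq_xyz h1.le h2.le (by fun_prop), intOn_eq_xyz h1.le h2.le (by fun_prop)]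
    simp only [hZ, intervalIntegral.integral_const, intervalIntegral.integral_const_mul,
      smul_eq_mul]
    ring
  have iC (c : ℝ) : intOn L1 L2 (fun _ => c) = 2 * L1 * L2 * c := by
    rw [intOn_eq_xyz h1.le h2.le (by fun_prop)]
    simp
    ring
  set J := intOn L1 L2 (fun p => u p ^ 2) with hJ
  have hq : ∀ q ∈ OmegaSet L1 L2, J ≤ 3 * (L1 * (L1 * intOn L1 L2 (fun p => dirD ex u p ^ 2))
      + L2 * (L1 * (L2 * W q.1)) + 2 * (2 * L1 * L2 * Z (q.1, q.2.1))) := by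
    intro q hq
    have hm := intOn_mono_on L1 L2 (F := fun p => (u p - u q) ^ 2)
      (G := fun p => 3 * (L1 * X p.2 + L2 * Y (q.1, p.2.2) + 2 * Z (q.1, q.2.1)))
      (by fun_prop) (by fun_prop) (fun p hp => sq_sub_le_three_segments hu hp hq)
    rw [intOn_const_mul, intOn_add _ _ (by fun_prop) (by fun_prop),
      intOn_add _ _ (by fun_prop) (by fun_prop), intOn_const_mul, intOn_const_mul,
      intOn_const_mul, iX, iY, iC] at hm
    refine le_trans ?_ hm
    have e : (fun p => (u p - u q) ^ 2) = fun p => u p ^ 2 - 2 * u q * u p + u q ^ 2 := by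
      funext p; ring
    rw [e, intOn_add _ _ (by fun_prop) (by fun_prop), intOn_sub _ _ (by fun_prop) (by fun_prop),
      intOn_const_mul, h0, iC]
    have : 0 ≤ 2 * L1 * L2 * u q ^ 2 := by positivity
    linarith
  have hm := intOn_mono_on L1 L2 (by fun_prop) (by fun_prop) hq
  rw [iC, intOn_const_mul, intOn_add _ _ (by fun_prop) (by fun_prop),
    intOn_add _ _ (by fun_prop) (by fun_prop), iC, intOn_const_mul, intOn_const_mul,
    intOn_const_mul, intOn_const_mul, intOn_const_mul, iW, iZ] at hm
  refine le_of_mul_le_mul_left (hm.trans_eq ?_) (by positivity : 0 < 2 * L1 * L2)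
  ring

lemma intOn_div_sq_le {L1 L2 : ℝ} {v w : Pt} (hv : ZeroMeanDir L1 L2 v)
    (hw : ZeroMeanDir L1 L2 w) {a b : Pt → ℝ} (ha : SmoothPer L1 L2 a) (hb : SmoothPer L1 L2 b) :
    intOn L1 L2 (fun p => (dirD v a p + dirD w b p) ^ 2)
      ≤ intOn L1 L2 (fun p => (dirD v a p ^ 2 + dirD w a p ^ 2)
        + (dirD v b p ^ 2 + dirD w b p ^ 2)) := by
  have c1 := (ha.dirD v).continuous
  have c2 := (ha.dirD w).continuous
  have c3 := (hb.dirD v).continuous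
  have c4 := (hb.dirD w).continuous
  have hk := intOn_dirD_mul_swap hv hw ha hb
  have hn : 0 ≤ intOn L1 L2 (fun p => (dirD w a p - dirD v b p) ^ 2) :=
    intOn_nonneg L1 L2 fun p => sq_nonneg _
  have e : (fun p => (dirD v a p ^ 2 + dirD w a p ^ 2) + (dirD v b p ^ 2 + dirD w b p ^ 2))
      = fun p => (dirD v a p + dirD w b p) ^ 2 + (dirD w a p - dirD v b p) ^ 2
        + 2 * (dirD w a p * dirD v b p - dirD v a p * dirD w b p) := by
    funext p; ring
  rw [e, intOn_add _ _ (by fun_prop) (by fun_prop), intOn_add _ _ (by fun_prop) (by fun_prop),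
    intOn_const_mul, intOn_sub _ _ (by fun_prop) (by fun_prop), hk]
  linarith

/-- the gradient of the planar divergence is controlled by the planar Laplacian. -/
lemma intOn_grad_div_sq_le {L1 L2 : ℝ} {v w : Pt} (hv : ZeroMeanDir L1 L2 v)
    (hw : ZeroMeanDir L1 L2 w) {a b : Pt → ℝ} (ha : SmoothPer L1 L2 a) (hb : SmoothPer L1 L2 b) :
    intOn L1 L2 (fun p => dirD v (fun q => dirD v a q + dirD w b q) p ^ 2
        + dirD w (fun q => dirD v a q + dirD w b q) p ^ 2)
      ≤ intOn L1 L2 (fun p => (dirD v (dirD v a) p + dirD w (dirD w a) p) ^ 2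
        + (dirD v (dirD v b) p + dirD w (dirD w b) p) ^ 2) := by
  have hd := (ha.dirD v).add (hb.dirD w)
  have hr := (hb.dirD v).sub (ha.dirD w)
  have hk := intOn_dirD_mul_swap hv hw hd hr
  have dv := dirD_add (ha.dirD v).smooth (hb.dirD w).smooth v
  have dw := dirD_add (ha.dirD v).smooth (hb.dirD w).smooth w
  have rv := dirD_sub (hb.dirD v).smooth (ha.dirD w).smooth v
  have rwd := dirD_sub (hb.dirD v).smooth (ha.dirD w).smooth w
  have sa := dirD_comm ha.smooth v w
  have sb := dirD_comm hb.smooth v w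
  have c1 := (hd.dirD v).continuous
  have c2 := (hd.dirD w).continuous
  have c3 := (hr.dirD v).continuous
  have c4 := (hr.dirD w).continuous
  have hn : 0 ≤ intOn L1 L2 (fun p => dirD v (fun q => dirD v b q - dirD w a q) p ^ 2
      + dirD w (fun q => dirD v b q - dirD w a q) p ^ 2) :=
    intOn_nonneg L1 L2 fun p => by positivity
  have e : (fun p => (dirD v (dirD v a) p + dirD w (dirD w a) p) ^ 2
        + (dirD v (dirD v b) p + dirD w (dirD w b) p) ^ 2)
      = fun p => (dirD v (fun q => dirD v a q + dirD w b q) p ^ 2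
        + dirD w (fun q => dirD v a q + dirD w b q) p ^ 2)
        + (dirD v (fun q => dirD v b q - dirD w a q) p ^ 2
        + dirD w (fun q => dirD v b q - dirD w a q) p ^ 2)
        + 2 * (dirD w (fun q => dirD v a q + dirD w b q) p
            * dirD v (fun q => dirD v b q - dirD w a q) p
          - dirD v (fun q => dirD v a q + dirD w b q) p
            * dirD w (fun q => dirD v b q - dirD w a q) p) := by
    funext p
    rw [dv, dw, rv, rwd, sa, sb]
    ring
  rw [e]
  generalize (fun p => dirD v a p + dirD w b p) = d at *
  generalize (fun p => dirD v b p - dirD w a p) = r at *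
  rw [intOn_add (G := fun p => 2 * (dirD w d p * dirD v r p - dirD v d p * dirD w r p)) _ _
      (by fun_prop) (by fun_prop),
    intOn_add (F := fun p => dirD v d p ^ 2 + dirD w d p ^ 2) _ _ (by fun_prop) (by fun_prop),
    intOn_const_mul, intOn_sub _ _ (by fun_prop) (by fun_prop), hk]
  linarith

lemma intOn_mul_second_nonneg {L1 L2 : ℝ} {v w : Pt} (hv : ZeroMeanDir L1 L2 v)
    (hw : ZeroMeanDir L1 L2 w) {a : Pt → ℝ} (ha : SmoothPer L1 L2 a) :
    0 ≤ intOn L1 L2 (fun p => dirD v (dirD v a) p * dirD w (dirD w a) p) := by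
  rw [intOn_dirD_mul_swap hv hw (ha.dirD v) (ha.dirD w), dirD_comm ha.smooth v w]
  exact intOn_nonneg L1 L2 fun p => mul_self_nonneg _

lemma intOn_lapH_sq_le {L1 L2 : ℝ} (h1 : 0 ≤ L1) (h2 : 0 ≤ L2) {a : Pt → ℝ}
    (ha : SmoothPer L1 L2 a) :
    intOn L1 L2 (fun p => (dirD ex (dirD ex a) p + dirD ey (dirD ey a) p) ^ 2)
      ≤ intOn L1 L2 (fun p =>
        (dirD ex (dirD ex a) p + dirD ey (dirD ey a) p + dirD ez (dirD ez a) p) ^ 2) := by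
  have hz := zeroMeanDir_ez h1 h2
  have n1 := intOn_mul_second_nonneg (zeroMeanDir_ex h1 h2) hz ha
  have n2 := intOn_mul_second_nonneg (zeroMeanDir_ey h1 h2) hz ha
  have n3 : 0 ≤ intOn L1 L2 (fun p => dirD ez (dirD ez a) p ^ 2) :=
    intOn_nonneg L1 L2 fun p => sq_nonneg _
  have c1 := ((ha.dirD ex).dirD ex).continuous
  have c2 := ((ha.dirD ey).dirD ey).continuous
  have c3 := ((ha.dirD ez).dirD ez).continuous
  have e : (fun p =>
        (dirD ex (dirD ex a) p + dirD ey (dirD ey a) p + dirD ez (dirD ez a) p) ^ 2)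
      = fun p => (dirD ex (dirD ex a) p + dirD ey (dirD ey a) p) ^ 2
        + dirD ez (dirD ez a) p ^ 2 + 2 * (dirD ex (dirD ex a) p * dirD ez (dirD ez a) p
        + dirD ey (dirD ey a) p * dirD ez (dirD ez a) p) := by
    funext p; ring
  rw [e, intOn_add _ _ (by fun_prop) (by fun_prop), intOn_add _ _ (by fun_prop) (by fun_prop),
    intOn_const_mul, intOn_add _ _ (by fun_prop) (by fun_prop)]
  linarith

lemma intOn_sq_le_grad {L1 L2 : ℝ} (h1 : 0 < L1) (h2 : 0 < L2) {u : Pt → ℝ}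
    (hu : ContDiff ℝ (⊤ : ℕ∞) u) (h0 : intOn L1 L2 u = 0) :
    intOn L1 L2 (fun p => u p ^ 2) ≤ 3 * (L1 ^ 2 + L2 ^ 2 + 4)
      * intOn L1 L2 (fun p => dirD ex u p ^ 2 + dirD ey u p ^ 2 + dirD ez u p ^ 2) := by
  have cx := (smooth_dirD hu ex).continuous
  have cy := (smooth_dirD hu ey).continuous
  have cz := (smooth_dirD hu ez).continuous
  have nx : 0 ≤ intOn L1 L2 (fun p => dirD ex u p ^ 2) := intOn_nonneg L1 L2 fun p => sq_nonneg _
  have ny : 0 ≤ intOn L1 L2 (fun p => dirD ey u p ^ 2) := intOn_nonneg L1 L2 fun p => sq_nonneg _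
  have nz : 0 ≤ intOn L1 L2 (fun p => dirD ez u p ^ 2) := intOn_nonneg L1 L2 fun p => sq_nonneg _
  refine (poincare h1 h2 hu h0).trans ?_
  rw [intOn_add _ _ (by fun_prop) (by fun_prop), intOn_add _ _ (by fun_prop) (by fun_prop)]
  nlinarith [mul_nonneg (sq_nonneg L1) ny, mul_nonneg (sq_nonneg L1) nz,
    mul_nonneg (sq_nonneg L2) nx, mul_nonneg (sq_nonneg L2) nz]

lemma intOn_grad_sq_le_lap {L1 L2 : ℝ} (h1 : 0 < L1) (h2 : 0 < L2) {u : Pt → ℝ}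
    (hu : SmoothPer L1 L2 u) (h0 : intOn L1 L2 u = 0) :
    intOn L1 L2 (fun p => dirD ex u p ^ 2 + dirD ey u p ^ 2 + dirD ez u p ^ 2)
      ≤ 3 * (L1 ^ 2 + L2 ^ 2 + 4) * intOn L1 L2 (fun p =>
        (dirD ex (dirD ex u) p + dirD ey (dirD ey u) p + dirD ez (dirD ez u) p) ^ 2) := by
  have hP := intOn_sq_le_grad h1 h2 hu.smooth h0
  set K := 3 * (L1 ^ 2 + L2 ^ 2 + 4)
  have hK : 0 < K := by positivity
  have c0 := hu.continuous
  have cx := (hu.dirD ex).continuous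
  have cy := (hu.dirD ey).continuous
  have cz := (hu.dirD ez).continuous
  have cxx := ((hu.dirD ex).dirD ex).continuous
  have cyy := ((hu.dirD ey).dirD ey).continuous
  have czz := ((hu.dirD ez).dirD ez).continuous
  set lp : Pt → ℝ :=
    fun p => dirD ex (dirD ex u) p + dirD ey (dirD ey u) p + dirD ez (dirD ez u) p with hlp
  have clp : Continuous lp := by fun_prop
  have hG : intOn L1 L2 (fun p => dirD ex u p ^ 2 + dirD ey u p ^ 2 + dirD ez u p ^ 2)
      = -intOn L1 L2 (fun p => u p * lp p) := by
    have e : (fun p => u p * lp p) = fun p => u p * dirD ex (dirD ex u) p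
        + u p * dirD ey (dirD ey u) p + u p * dirD ez (dirD ez u) p := by
      funext p; simp only [hlp]; ring
    rw [e, intOn_add _ _ (by fun_prop) (by fun_prop), intOn_add _ _ (by fun_prop) (by fun_prop),
      intOn_add _ _ (by fun_prop) (by fun_prop), intOn_add _ _ (by fun_prop) (by fun_prop),
      intOn_dirD_sq (zeroMeanDir_ex h1.le h2.le) hu, intOn_dirD_sq (zeroMeanDir_ey h1.le h2.le) hu,
      intOn_dirD_sq (zeroMeanDir_ez h1.le h2.le) hu]
    ring
  have hn : 0 ≤ intOn L1 L2 (fun p => (u p + K * lp p) ^ 2) :=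
    intOn_nonneg L1 L2 fun p => sq_nonneg _
  have e : (fun p => (u p + K * lp p) ^ 2)
      = fun p => u p ^ 2 + (2 * K) * (u p * lp p) + K ^ 2 * lp p ^ 2 := by
    funext p; ring
  rw [e, intOn_add _ _ (by fun_prop) (by fun_prop), intOn_add _ _ (by fun_prop) (by fun_prop),
    intOn_const_mul, intOn_const_mul] at hn
  set G := intOn L1 L2 (fun p => dirD ex u p ^ 2 + dirD ey u p ^ 2 + dirD ez u p ^ 2)
  refine le_of_mul_le_mul_left ?_ hK
  rw [show intOn L1 L2 (fun p => u p * lp p) = -G by linarith] at hn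
  nlinarith

/-- bounds on the vertical component recovered from incompressibility. -/
theorem stmt_3 (L1 L2 : ℝ) (hL1 : 0 < L1) (hL2 : 0 < L2) :
    ∃ C > 0, ∀ (u1 u2 u3 : Pt → ℝ),
      ContDiff ℝ (⊤ : ℕ∞) u1 → ContDiff ℝ (⊤ : ℕ∞) u2 → ContDiff ℝ (⊤ : ℕ∞) u3 →
      Periodic3 L1 L2 u1 → Periodic3 L1 L2 u2 → Periodic3 L1 L2 u3 →
      (∀ p, pdx u1 p + pdy u2 p + pdz u3 p = 0) →
      (∀ x y : ℝ, u3 (x, y, 0) = 0) →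
      intOn L1 L2 u1 = 0 → intOn L1 L2 u2 = 0 → intOn L1 L2 u3 = 0 →
      (L2n L1 L2 u3
          ≤ Real.sqrt (intOn L1 L2 (fun p => gradHSq u1 p + gradHSq u2 p))) ∧
      (L2n L1 L2 (pdz u3)
          ≤ Real.sqrt (intOn L1 L2 (fun p => gradHSq u1 p + gradHSq u2 p))) ∧
      (L2gradH L1 L2 u3
          ≤ Real.sqrt (intOn L1 L2 (fun p => (lapH u1 p)^2 + (lapH u2 p)^2))) ∧
      (Real.sqrt (L2sq L1 L2 u1 + L2sq L1 L2 u2 + L2sq L1 L2 u3)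
          ≤ C * vGradn L1 L2 (fun p => (u1 p, u2 p))) ∧
      (Real.sqrt (intOn L1 L2 (fun p => gradHSq u1 p + gradHSq u2 p + gradHSq u3 p))
          ≤ C * vLapn L1 L2 (fun p => (u1 p, u2 p))) := by
  refine ⟨√(3 * (L1 ^ 2 + L2 ^ 2 + 4) + 1), by positivity, ?_⟩
  intro u1 u2 u3 s1 s2 s3 per1 per2 per3 hdiv h0 m1 m2 _
  have hK : 0 < 3 * (L1 ^ 2 + L2 ^ 2 + 4) := by positivity
  have t1 : SmoothPer L1 L2 u1 := ⟨s1, per1⟩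
  have t2 : SmoothPer L1 L2 u2 := ⟨s2, per2⟩
  have t3 : SmoothPer L1 L2 u3 := ⟨s3, per3⟩
  have zx := zeroMeanDir_ex hL1.le hL2.le
  have zy := zeroMeanDir_ey hL1.le hL2.le
  simp only [L2n, L2gradH, vGradn, vLapn, L2sq, vGradSq, vLapSq]
  rw [← Real.sqrt_mul (by positivity), ← Real.sqrt_mul (by positivity)]
  simp only [show c1 (fun p => (u1 p, u2 p)) = u1 from rfl,
    show c2 (fun p => (u1 p, u2 p)) = u2 from rfl]
  have eH {u : Pt → ℝ} (hu : ContDiff ℝ (⊤ : ℕ∞) u) :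
      gradHSq u = fun p => dirD ex u p ^ 2 + dirD ey u p ^ 2 := by
    funext p; simp only [gradHSq, pdx_eq_dirD hu, pdy_eq_dirD hu]
  have eG {u : Pt → ℝ} (hu : ContDiff ℝ (⊤ : ℕ∞) u) :
      gradSq u = fun p => dirD ex u p ^ 2 + dirD ey u p ^ 2 + dirD ez u p ^ 2 := by
    funext p; simp only [gradSq, pdx_eq_dirD hu, pdy_eq_dirD hu, pdz_eq_dirD hu]
  have eLH {u : Pt → ℝ} (hu : ContDiff ℝ (⊤ : ℕ∞) u) :
      lapH u = fun p => dirD ex (dirD ex u) p + dirD ey (dirD ey u) p := by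
    funext p
    simp only [lapH, pdx_eq_dirD hu, pdy_eq_dirD hu, pdx_eq_dirD (smooth_dirD hu ex),
      pdy_eq_dirD (smooth_dirD hu ey)]
  have eL {u : Pt → ℝ} (hu : ContDiff ℝ (⊤ : ℕ∞) u) :
      lap u = fun p => dirD ex (dirD ex u) p + dirD ey (dirD ey u) p + dirD ez (dirD ez u) p := by
    funext p
    simp only [lap, pdx_eq_dirD hu, pdy_eq_dirD hu, pdz_eq_dirD hu,
      pdx_eq_dirD (smooth_dirD hu ex), pdy_eq_dirD (smooth_dirD hu ey),
      pdz_eq_dirD (smooth_dirD hu ez)]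
  have hd : dirD ez u3 = fun p => -(dirD ex u1 p + dirD ey u2 p) := by
    funext p
    have := hdiv p
    rw [pdx_eq_dirD s1, pdy_eq_dirD s2, pdz_eq_dirD s3] at this
    linarith
  simp only [eH s1, eH s2, eH s3, eG s1, eG s2, eLH s1, eLH s2, eL s1, eL s2, pdz_eq_dirD s3]
  have b2 : intOn L1 L2 (fun p => dirD ez u3 p ^ 2) ≤ intOn L1 L2 (fun p =>
      (dirD ex u1 p ^ 2 + dirD ey u1 p ^ 2) + (dirD ex u2 p ^ 2 + dirD ey u2 p ^ 2)) := by
    rw [hd]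
    simp only [neg_sq]
    exact intOn_div_sq_le zx zy t1 t2
  have b1 := (intOn_sq_le_of_zero hL1.le hL2.le s3 h0).trans b2
  have zeroX (x y : ℝ) : dirD ex u3 (x, y, 0) = 0 := by
    rw [← (hasDerivAt_x s3 x y 0).deriv]
    simp [h0]
  have zeroY (x y : ℝ) : dirD ey u3 (x, y, 0) = 0 := by
    rw [← (hasDerivAt_y s3 x y 0).deriv]
    simp [h0]
  have x1 := (t1.dirD ex).continuous
  have y1 := (t1.dirD ey).continuous
  have z1 := (t1.dirD ez).continuous
  have x2 := (t2.dirD ex).continuous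
  have y2 := (t2.dirD ey).continuous
  have z2 := (t2.dirD ez).continuous
  have x3 := (t3.dirD ex).continuous
  have y3 := (t3.dirD ey).continuous
  have xx1 := ((t1.dirD ex).dirD ex).continuous
  have yy1 := ((t1.dirD ey).dirD ey).continuous
  have zz1 := ((t1.dirD ez).dirD ez).continuous
  have xx2 := ((t2.dirD ex).dirD ex).continuous
  have yy2 := ((t2.dirD ey).dirD ey).continuous
  have zz2 := ((t2.dirD ez).dirD ez).continuous
  have b3 : intOn L1 L2 (fun p => dirD ex u3 p ^ 2 + dirD ey u3 p ^ 2)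
      ≤ intOn L1 L2 (fun p => (dirD ex (dirD ex u1) p + dirD ey (dirD ey u1) p) ^ 2
        + (dirD ex (dirD ex u2) p + dirD ey (dirD ey u2) p) ^ 2) := by
    refine le_trans ?_ (intOn_grad_div_sq_le zx zy t1 t2)
    have td := (t1.dirD ex).add (t2.dirD ey)
    have cdx := (td.dirD ex).continuous
    have cdy := (td.dirD ey).continuous
    have i1 := intOn_sq_le_of_zero hL1.le hL2.le (t3.dirD ex).smooth zeroX
    have i2 := intOn_sq_le_of_zero hL1.le hL2.le (t3.dirD ey).smooth zeroY
    rw [dirD_comm s3, hd, dirD_neg] at i1 i2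
    simp only [neg_sq] at i1 i2
    rw [intOn_add _ _ (by fun_prop) (by fun_prop), intOn_add _ _ (by fun_prop) (by fun_prop)]
    exact add_le_add i1 i2
  refine ⟨Real.sqrt_le_sqrt b1, Real.sqrt_le_sqrt b2, Real.sqrt_le_sqrt b3,
    Real.sqrt_le_sqrt ?_, Real.sqrt_le_sqrt ?_⟩
  · have p1 := intOn_sq_le_grad hL1 hL2 s1 m1
    have p2 := intOn_sq_le_grad hL1 hL2 s2 m2
    have hm : intOn L1 L2 (fun p =>
        (dirD ex u1 p ^ 2 + dirD ey u1 p ^ 2) + (dirD ex u2 p ^ 2 + dirD ey u2 p ^ 2))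
        ≤ intOn L1 L2 (fun p => (dirD ex u1 p ^ 2 + dirD ey u1 p ^ 2 + dirD ez u1 p ^ 2)
          + (dirD ex u2 p ^ 2 + dirD ey u2 p ^ 2 + dirD ez u2 p ^ 2)) :=
      intOn_mono L1 L2 (by fun_prop) (by fun_prop) fun p => by
        linarith [sq_nonneg (dirD ez u1 p), sq_nonneg (dirD ez u2 p)]
    have hs := intOn_add L1 L2
      (F := fun p => dirD ex u1 p ^ 2 + dirD ey u1 p ^ 2 + dirD ez u1 p ^ 2)
      (G := fun p => dirD ex u2 p ^ 2 + dirD ey u2 p ^ 2 + dirD ez u2 p ^ 2)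
      (by fun_prop) (by fun_prop)
    rw [hs] at hm ⊢
    linarith
  · have p1 := intOn_grad_sq_le_lap hL1 hL2 t1 m1
    have p2 := intOn_grad_sq_le_lap hL1 hL2 t2 m2
    have l1 := intOn_lapH_sq_le hL1.le hL2.le t1
    have l2 := intOn_lapH_sq_le hL1.le hL2.le t2
    have g1 : intOn L1 L2 (fun p => dirD ex u1 p ^ 2 + dirD ey u1 p ^ 2)
        ≤ intOn L1 L2 (fun p => dirD ex u1 p ^ 2 + dirD ey u1 p ^ 2 + dirD ez u1 p ^ 2) :=
      intOn_mono L1 L2 (by fun_prop) (by fun_prop) fun p => by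
        linarith [sq_nonneg (dirD ez u1 p)]
    have g2 : intOn L1 L2 (fun p => dirD ex u2 p ^ 2 + dirD ey u2 p ^ 2)
        ≤ intOn L1 L2 (fun p => dirD ex u2 p ^ 2 + dirD ey u2 p ^ 2 + dirD ez u2 p ^ 2) :=
      intOn_mono L1 L2 (by fun_prop) (by fun_prop) fun p => by
        linarith [sq_nonneg (dirD ez u2 p)]
    rw [intOn_add (F := fun p => (dirD ex (dirD ex u1) p + dirD ey (dirD ey u1) p) ^ 2) _ _
      (by fun_prop) (by fun_prop)] at b3
    rw [intOn_add (G := fun p => dirD ex u3 p ^ 2 + dirD ey u3 p ^ 2) _ _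
        (by fun_prop) (by fun_prop),
      intOn_add (F := fun p => dirD ex u1 p ^ 2 + dirD ey u1 p ^ 2) _ _
        (by fun_prop) (by fun_prop),
      intOn_add (F := fun p => (dirD ex (dirD ex u1) p + dirD ey (dirD ey u1) p
        + dirD ez (dirD ez u1) p) ^ 2) _ _ (by fun_prop) (by fun_prop)]
    linarith
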